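/- Let N ≥ 1 and let f : ℝ → ℝ be continuously differentiable with f(0) = 0 and f'(0) < 0. If u : ℝ^N → ℝ is a classical solution of Δu + f(u) = 0 in ℝ^N which is localized (u(x) → 0 as |x| → ∞) and stable (for every smooth compactly supported φ : ℝ^N → ℝ one has ∫_{ℝ^N} (|∇φ(x)|² − f'(u(x)) φ(x)²) dx ≥ 0), then u is identically zero. -/

import Mathlib

open MeasureTheory Filter

/-- The Laplacian of `u : ℝ^N → ℝ`: the sum of the second pure partial derivatives. -/
noncomputable def coordLaplacian {N : ℕ} (u : EuclideanSpace ℝ (Fin N) → ℝ)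
    (x : EuclideanSpace ℝ (Fin N)) : ℝ :=
  ∑ i : Fin N,
    fderiv ℝ (fun y => fderiv ℝ u y (EuclideanSpace.single i 1)) x (EuclideanSpace.single i 1)

open scoped RealInnerProductSpace Topology Convolution

section Gradient

variable {E : Type*} [NormedAddCommGroup E] [InnerProductSpace ℝ E] [CompleteSpace E]

lemma inner_gradient (g : E → ℝ) (x v : E) : ⟪gradient g x, v⟫ = fderiv ℝ g x v := by
  simp [gradient]

lemma norm_gradient (g : E → ℝ) (x : E) : ‖gradient g x‖ = ‖fderiv ℝ g x‖ := by
  simp [gradient]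

lemma HasFDerivAt.gradient_eq_of_forall_inner {g : E → ℝ} {g' : E →L[ℝ] ℝ} {x v : E}
    (hg : HasFDerivAt g g' x) (h : ∀ y, g' y = ⟪v, y⟫) : gradient g x = v :=
  ext_inner_right ℝ fun y => by rw [inner_gradient, hg.fderiv, h]

lemma ContDiff.continuous_gradient {g : E → ℝ} (hg : ContDiff ℝ 1 g) :
    Continuous (gradient g) :=
  (InnerProductSpace.toDual ℝ E).symm.continuous.comp (hg.continuous_fderiv one_ne_zero)

lemma gradient_mul {g h : E → ℝ} {x : E} (hg : DifferentiableAt ℝ g x)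
    (hh : DifferentiableAt ℝ h x) :
    gradient (fun y => g y * h y) x = g x • gradient h x + h x • gradient g x := by
  refine (hg.hasFDerivAt.mul hh.hasFDerivAt).gradient_eq_of_forall_inner fun y => ?_
  simp [inner_add_left, real_inner_smul_left]

lemma gradient_add_const_mul {g h : E → ℝ} {x : E} (c : ℝ) (hg : DifferentiableAt ℝ g x)
    (hh : DifferentiableAt ℝ h x) :
    gradient (fun y => g y + c * h y) x = gradient g x + c • gradient h x := by
  refine (hg.hasFDerivAt.add (hh.hasFDerivAt.const_mul c)).gradient_eq_of_forall_inner fun y => ?_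
  simp [inner_add_left, real_inner_smul_left]

lemma gradient_comp_deriv {p : ℝ → ℝ} {g : E → ℝ} {x : E} {p' : ℝ} (hp : HasDerivAt p p' (g x))
    (hg : DifferentiableAt ℝ g x) :
    gradient (fun y => p (g y)) x = p' • gradient g x := by
  refine (hp.comp_hasFDerivAt x hg.hasFDerivAt).gradient_eq_of_forall_inner fun y => ?_
  simp [real_inner_smul_left]

lemma gradient_eq_zero_of_notMem_tsupport {g : E → ℝ} {x : E} (hx : x ∉ tsupport g) :
    gradient g x = 0 := by
  rw [← norm_eq_zero, norm_gradient, norm_eq_zero]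
  exact image_eq_zero_of_notMem_tsupport fun h => hx (tsupport_fderiv_subset ℝ h)

end Gradient

section Approximation

lemma HasCompactSupport.integrable_of_eq_zero {E : Type*} [TopologicalSpace E] [MeasurableSpace E]
    [OpensMeasurableSpace E] [R1Space E] {μ : Measure E} [IsFiniteMeasureOnCompacts μ]
    {g F : E → ℝ} (hg : HasCompactSupport g)
    (hF : Continuous F) (h : ∀ x ∉ tsupport g, F x = 0) : Integrable F μ :=
  hF.integrable_of_hasCompactSupport (HasCompactSupport.intro hg h)

variable {E : Type*} [NormedAddCommGroup E] [MeasurableSpace E] [BorelSpace E] {μ : Measure E}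
  [InnerProductSpace ℝ E] [FiniteDimensional ℝ E] [μ.IsAddHaarMeasure]

/-- A compactly supported `C¹` function is a limit of smooth ones, strongly enough for integrals of
continuous expressions in the function and its gradient to converge. -/
lemma exists_smooth_tendsto_integral {φ : E → ℝ} (hφ : ContDiff ℝ 1 φ)
    (hc : HasCompactSupport φ) :
    ∃ ψ : ℕ → E → ℝ, (∀ n, ContDiff ℝ (⊤ : ℕ∞) (ψ n)) ∧ (∀ n, HasCompactSupport (ψ n)) ∧
      ∀ H : E → ℝ → E → ℝ, Continuous (fun q : E × ℝ × E => H q.1 q.2.1 q.2.2) →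
        (∀ x, H x 0 0 = 0) →
        Tendsto (fun n => ∫ x, H x (ψ n x) (gradient (ψ n) x) ∂μ) atTop
          (𝓝 (∫ x, H x (φ x) (gradient φ x) ∂μ)) := by
  let b : ℕ → ContDiffBump (0 : E) := fun n =>
    ⟨1 / (n + 2), 1 / (n + 1), by positivity, by
      apply one_div_lt_one_div_of_lt <;> first | positivity | linarith⟩
  have hb1 : ∀ n, (b n).rOut ≤ 1 := fun n => by
    show (1 : ℝ) / (n + 1) ≤ 1
    rw [div_le_one (by positivity)]
    simp
  have hb0 : Tendsto (fun n => (b n).rOut) atTop (𝓝 0) := tendsto_one_div_add_atTop_nhds_zero_nat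
  let ψ : ℕ → E → ℝ := fun n => (b n).normed μ ⋆[ContinuousLinearMap.lsmul ℝ ℝ, μ] φ
  have hφ' : Continuous (fderiv ℝ φ) := hφ.continuous_fderiv one_ne_zero
  have hfd : ∀ n x, fderiv ℝ (ψ n) x =
      ((b n).normed μ ⋆[ContinuousLinearMap.lsmul ℝ ℝ, μ] fderiv ℝ φ) x := fun n x => by
    refine (hc.hasFDerivAt_convolution_right _
      (b n).continuous_normed.locallyIntegrable hφ x).fderiv.trans ?_
    congr 1
  obtain ⟨C, hC⟩ := hφ.continuous.bounded_above_of_compact_support hc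
  obtain ⟨C', hC'⟩ := hφ'.bounded_above_of_compact_support (hc.fderiv ℝ)
  have hbd : ∀ n x, ‖ψ n x‖ ≤ 3 * C := fun n x => by
    have h1 : dist (ψ n x) (φ x) ≤ 2 * C :=
      (b n).dist_normed_convolution_le hφ.continuous.aestronglyMeasurable fun y _ => by
        rw [dist_eq_norm]; linarith [norm_sub_le (φ y) (φ x), hC y, hC x]
    rw [dist_eq_norm] at h1
    linarith [norm_le_norm_add_norm_sub (φ x) (ψ n x), hC x, norm_sub_rev (φ x) (ψ n x)]
  have hbd' : ∀ n x, ‖gradient (ψ n) x‖ ≤ 3 * C' := fun n x => by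
    have h1 : dist (fderiv ℝ (ψ n) x) (fderiv ℝ φ x) ≤ 2 * C' := by
      rw [hfd]
      refine (b n).dist_normed_convolution_le hφ'.aestronglyMeasurable fun y _ => by
        rw [dist_eq_norm]; linarith [norm_sub_le (fderiv ℝ φ y) (fderiv ℝ φ x), hC' y, hC' x]
    rw [dist_eq_norm] at h1
    rw [norm_gradient]
    linarith [norm_le_norm_add_norm_sub (fderiv ℝ φ x) (fderiv ℝ (ψ n) x), hC' x,
      norm_sub_rev (fderiv ℝ φ x) (fderiv ℝ (ψ n) x)]
  obtain ⟨r, hr⟩ := hc.isCompact.isBounded.subset_closedBall (0 : E)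
  have hsupp : ∀ n, Function.support (ψ n) ⊆ Metric.closedBall 0 (r + 1) := fun n x hx => by
    obtain ⟨y, hy, z, hz, rfl⟩ := support_convolution_subset (L := ContinuousLinearMap.lsmul ℝ ℝ) hx
    rw [(b n).support_normed_eq] at hy
    have h1 := hr (subset_tsupport _ hz)
    simp only [Metric.mem_ball, Metric.mem_closedBall, dist_zero_right] at hy h1 ⊢
    linarith [norm_add_le y z, hb1 n]
  have htsupp : ∀ n, tsupport (ψ n) ⊆ Metric.closedBall 0 (r + 1) := fun n =>
    closure_minimal (hsupp n) Metric.isClosed_closedBall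
  have hK : IsCompact (Metric.closedBall (0 : E) (r + 1)) := isCompact_closedBall _ _
  refine ⟨ψ, fun n => (b n).hasCompactSupport_normed.contDiff_convolution_left _
    (b n).contDiff_normed hφ.continuous.locallyIntegrable,
    fun n => hK.of_isClosed_subset (isClosed_tsupport _) (htsupp n), fun H hH hH0 => ?_⟩
  obtain ⟨M, hM⟩ := (hK.prod ((isCompact_closedBall (0 : ℝ) (3 * C)).prod
    (isCompact_closedBall (0 : E) (3 * C')))).exists_bound_of_continuousOn hH.continuousOn
  have hψ1 : ∀ n, ContDiff ℝ 1 (ψ n) := fun n =>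
    (b n).hasCompactSupport_normed.contDiff_convolution_left _
      (b n).contDiff_normed hφ.continuous.locallyIntegrable
  refine tendsto_integral_of_dominated_convergence
    ((Metric.closedBall (0 : E) (r + 1)).indicator fun _ => M) (fun n => ?_) ?_ (fun n => ?_) ?_
  · exact (hH.comp (continuous_id.prodMk
      ((hψ1 n).continuous.prodMk (hψ1 n).continuous_gradient))).aestronglyMeasurable
  · rw [integrable_indicator_iff measurableSet_closedBall]
    exact integrableOn_const hK.measure_ne_top
  · refine Eventually.of_forall fun x => ?_
    by_cases hx : x ∈ Metric.closedBall (0 : E) (r + 1)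
    · rw [Set.indicator_of_mem hx]
      exact hM (x, ψ n x, gradient (ψ n) x) ⟨hx, by simpa using hbd n x, by simpa using hbd' n x⟩
    · have hx' : x ∉ tsupport (ψ n) := fun h => hx (htsupp n h)
      rw [Set.indicator_of_notMem hx, image_eq_zero_of_notMem_tsupport hx',
        gradient_eq_zero_of_notMem_tsupport hx', hH0, norm_zero]
  · refine Eventually.of_forall fun x => ?_
    have h1 : Tendsto (fun n => ψ n x) atTop (𝓝 (φ x)) :=
      ContDiffBump.convolution_tendsto_right_of_continuous hb0 hφ.continuous x
    have h2 : Tendsto (fun n => gradient (ψ n) x) atTop (𝓝 (gradient φ x)) := by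
      refine ((InnerProductSpace.toDual ℝ E).symm.continuous.tendsto _).comp ?_
      simp_rw [hfd]
      exact ContDiffBump.convolution_tendsto_right_of_continuous hb0 hφ' x
    exact (hH.tendsto (x, φ x, gradient φ x)).comp
      (tendsto_const_nhds.prodMk_nhds (h1.prodMk_nhds h2))

end Approximation

section IntegrationByParts

variable {N : ℕ}

lemma inner_gradient_gradient (g h : EuclideanSpace ℝ (Fin N) → ℝ)
    (x : EuclideanSpace ℝ (Fin N)) :
    ⟪gradient g x, gradient h x⟫ = ∑ i : Fin N,
      fderiv ℝ g x (EuclideanSpace.single i 1) * fderiv ℝ h x (EuclideanSpace.single i 1) := by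
  rw [← (EuclideanSpace.basisFun (Fin N) ℝ).sum_inner_mul_inner]
  simp_rw [EuclideanSpace.basisFun_apply, inner_gradient,
    real_inner_comm (gradient h x), inner_gradient]

lemma ContDiff.fderiv_apply_const {E : Type*} [NormedAddCommGroup E] [NormedSpace ℝ E]
    {m n : WithTop ℕ∞} {h : E → ℝ}
    (hh : ContDiff ℝ n h) (hmn : m + 1 ≤ n) (v : E) : ContDiff ℝ m fun y => fderiv ℝ h y v :=
  (hh.fderiv_right hmn).clm_apply contDiff_const

lemma fderiv_fderiv_apply_comm {E : Type*} [NormedAddCommGroup E] [NormedSpace ℝ E] {h : E → ℝ}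
    (hh : ContDiff ℝ 2 h) (x v w : E) :
    fderiv ℝ (fun y => fderiv ℝ h y v) x w = fderiv ℝ (fun y => fderiv ℝ h y w) x v := by
  have hd : DifferentiableAt ℝ (fderiv ℝ h) x :=
    (hh.fderiv_right (m := 1) le_rfl).differentiable one_ne_zero x
  have key : ∀ a : E, fderiv ℝ (fun y => fderiv ℝ h y a) x =
      (ContinuousLinearMap.apply ℝ ℝ a).comp (fderiv ℝ (fderiv ℝ h) x) := fun a =>
    ((ContinuousLinearMap.apply ℝ ℝ a).hasFDerivAt.comp x hd.hasFDerivAt).fderiv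
  have hs : IsSymmSndFDerivAt ℝ h x := hh.contDiffAt.isSymmSndFDerivAt (by simp)
  rw [key, key]
  exact hs w v

lemma ContDiff.continuous_coordLaplacian {h : EuclideanSpace ℝ (Fin N) → ℝ}
    (hh : ContDiff ℝ 2 h) : Continuous (coordLaplacian h) :=
  continuous_finsetSum _ fun _ _ =>
    (((hh.fderiv_apply_const (m := 1) le_rfl _).continuous_fderiv one_ne_zero).clm_apply
      continuous_const)

lemma fderiv_apply_eq_zero_of_notMem_tsupport {E : Type*} [NormedAddCommGroup E]
    [NormedSpace ℝ E] {h : E → ℝ} {x : E} (hx : x ∉ tsupport h) (v : E) :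
    fderiv ℝ h x v = 0 := by
  rw [image_eq_zero_of_notMem_tsupport fun h' => hx (tsupport_fderiv_subset ℝ h')]
  rfl

lemma fderiv_fderiv_apply_eq_zero_of_notMem_tsupport {E : Type*} [NormedAddCommGroup E]
    [NormedSpace ℝ E] {h : E → ℝ} {x : E} (hx : x ∉ tsupport h) (v w : E) :
    fderiv ℝ (fun y => fderiv ℝ h y v) x w = 0 :=
  fderiv_apply_eq_zero_of_notMem_tsupport (fun h' => hx (tsupport_fderiv_apply_subset ℝ v h')) w

lemma coordLaplacian_eq_zero_of_notMem_tsupport {h : EuclideanSpace ℝ (Fin N) → ℝ}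
    {x : EuclideanSpace ℝ (Fin N)} (hx : x ∉ tsupport h) : coordLaplacian h x = 0 :=
  Finset.sum_eq_zero fun _ _ => fderiv_fderiv_apply_eq_zero_of_notMem_tsupport hx _ _

lemma integral_mul_fderiv_eq_neg_of_hasCompactSupport {g h : EuclideanSpace ℝ (Fin N) → ℝ}
    (hg : ContDiff ℝ 1 g) (hh : ContDiff ℝ 1 h)
    (hc : HasCompactSupport g ∨ HasCompactSupport h) (v : EuclideanSpace ℝ (Fin N)) :
    ∫ x, g x * fderiv ℝ h x v = -∫ x, fderiv ℝ g x v * h x := by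
  have cg' : Continuous fun x => fderiv ℝ g x v :=
    (hg.continuous_fderiv one_ne_zero).clm_apply continuous_const
  have ch' : Continuous fun x => fderiv ℝ h x v :=
    (hh.continuous_fderiv one_ne_zero).clm_apply continuous_const
  have cg := hg.continuous
  have ch := hh.continuous
  apply integral_mul_fderiv_eq_neg_fderiv_mul_of_integrable
  · rcases hc with hc | hc <;> refine hc.integrable_of_eq_zero (cg'.mul ch) fun x hx => ?_ <;>
      simp [image_eq_zero_of_notMem_tsupport hx, fderiv_apply_eq_zero_of_notMem_tsupport hx]
  · rcases hc with hc | hc <;> refine hc.integrable_of_eq_zero (cg.mul ch') fun x hx => ?_ <;>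
      simp [image_eq_zero_of_notMem_tsupport hx, fderiv_apply_eq_zero_of_notMem_tsupport hx]
  · rcases hc with hc | hc <;> refine hc.integrable_of_eq_zero (cg.mul ch) fun x hx => ?_ <;>
      simp [image_eq_zero_of_notMem_tsupport hx]
  · exact fun x _ => hg.differentiable one_ne_zero x
  · exact fun x _ => hh.differentiable one_ne_zero x

/-- The first Green identity. -/
lemma integral_inner_gradient_eq_neg_integral_mul_coordLaplacian
    {g h : EuclideanSpace ℝ (Fin N) → ℝ} (hg : ContDiff ℝ 1 g) (hh : ContDiff ℝ 2 h)
    (hc : HasCompactSupport g ∨ HasCompactSupport h) :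
    ∫ x, ⟪gradient g x, gradient h x⟫ = -∫ x, g x * coordLaplacian h x := by
  have cg' : ∀ v, Continuous fun x => fderiv ℝ g x v := fun v =>
    (hg.continuous_fderiv one_ne_zero).clm_apply continuous_const
  have hh1 : ∀ v, ContDiff ℝ 1 fun x => fderiv ℝ h x v := hh.fderiv_apply_const le_rfl
  have ch'' : ∀ v, Continuous fun x => fderiv ℝ (fun y => fderiv ℝ h y v) x v := fun v =>
    ((hh1 v).continuous_fderiv one_ne_zero).clm_apply continuous_const
  simp_rw [inner_gradient_gradient, coordLaplacian, Finset.mul_sum]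
  rw [integral_finsetSum, integral_finsetSum, ← Finset.sum_neg_distrib]
  · refine Finset.sum_congr rfl fun i _ => ?_
    rw [integral_mul_fderiv_eq_neg_of_hasCompactSupport hg (hh1 _)
      (hc.imp_right fun h => h.fderiv_apply ℝ _), neg_neg]
  · intro i _
    rcases hc with hc | hc <;>
      refine hc.integrable_of_eq_zero (hg.continuous.mul (ch'' _)) fun x hx => ?_ <;>
      simp [image_eq_zero_of_notMem_tsupport hx, fderiv_fderiv_apply_eq_zero_of_notMem_tsupport hx]
  · intro i _
    rcases hc with hc | hc <;>
      refine hc.integrable_of_eq_zero ((cg' _).mul (hh1 _).continuous) fun x hx => ?_ <;>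
      simp [fderiv_apply_eq_zero_of_notMem_tsupport hx]

end IntegrationByParts

section StableOperator

variable {N : ℕ} {V w : EuclideanSpace ℝ (Fin N) → ℝ}

lemma integrable_quadraticForm {φ : EuclideanSpace ℝ (Fin N) → ℝ} (hV : Continuous V)
    (hφ : ContDiff ℝ 1 φ) (hc : HasCompactSupport φ) :
    Integrable fun x => ‖gradient φ x‖ ^ 2 - V x * φ x ^ 2 := by
  have := hφ.continuous_gradient
  have := hφ.continuous
  refine hc.integrable_of_eq_zero (by fun_prop) fun x hx => ?_
  simp [image_eq_zero_of_notMem_tsupport hx, gradient_eq_zero_of_notMem_tsupport hx]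

lemma integrable_bilinearForm {g φ : EuclideanSpace ℝ (Fin N) → ℝ} (hV : Continuous V)
    (hg : ContDiff ℝ 1 g) (hφ : ContDiff ℝ 1 φ) (hc : HasCompactSupport φ) :
    Integrable fun x => ⟪gradient g x, gradient φ x⟫ - V x * g x * φ x := by
  have := hφ.continuous_gradient
  have := hφ.continuous
  have := hg.continuous_gradient
  have := hg.continuous
  refine hc.integrable_of_eq_zero (by fun_prop) fun x hx => ?_
  simp [image_eq_zero_of_notMem_tsupport hx, gradient_eq_zero_of_notMem_tsupport hx]

/-- The weak form of an operator agrees with its distributional form. -/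
lemma integral_bilinearForm {g φ : EuclideanSpace ℝ (Fin N) → ℝ} (hV : Continuous V)
    (hg : ContDiff ℝ 1 g) (hφ : ContDiff ℝ 2 φ) (hc : HasCompactSupport φ) :
    ∫ x, (⟪gradient g x, gradient φ x⟫ - V x * g x * φ x) =
      -∫ x, g x * (coordLaplacian φ x + V x * φ x) := by
  have c1 := (hφ.of_le one_le_two).continuous_gradient
  have c2 := hφ.continuous
  have c3 := hg.continuous_gradient
  have c4 := hg.continuous
  have c5 := hφ.continuous_coordLaplacian
  have i1 : Integrable fun x => V x * g x * φ x :=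
    hc.integrable_of_eq_zero (by fun_prop) fun x hx => by
      simp [image_eq_zero_of_notMem_tsupport hx]
  have i2 : Integrable fun x => g x * coordLaplacian φ x :=
    hc.integrable_of_eq_zero (by fun_prop) fun x hx => by
      simp [coordLaplacian_eq_zero_of_notMem_tsupport hx]
  rw [integral_sub (hc.integrable_of_eq_zero (by fun_prop) fun x hx => by
    simp [gradient_eq_zero_of_notMem_tsupport hx]) i1,
    integral_inner_gradient_eq_neg_integral_mul_coordLaplacian hg hφ (Or.inr hc), sub_eq_add_neg,
    ← neg_add, ← integral_add i2 i1]
  congr 2 with x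
  ring

lemma norm_sq_add_le_of_sq_le {E : Type*} [NormedAddCommGroup E] [InnerProductSpace ℝ E]
    (G K P : E) {a s ε η t : ℝ} (hs : s ≠ 0) (hsq : s ^ 2 = a ^ 2 + ε ^ 2) :
    ‖(s • K + η • (a / s) • G) + t • P‖ ^ 2 ≤ a ^ 2 * ‖K‖ ^ 2 + ⟪G, a • (2 * η) • K + η ^ 2 • G⟫
      + ε ^ 2 * ‖K‖ ^ 2 + 2 * t * ⟪s • K + η • (a / s) • G, P⟫ + t ^ 2 * ‖P‖ ^ 2 := by
  have h1 : (a / s) ^ 2 ≤ 1 := by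
    rw [div_pow, div_le_one (by positivity)]
    nlinarith [sq_nonneg ε]
  have h2 : ‖s • K + η • (a / s) • G‖ ^ 2 =
      s ^ 2 * ‖K‖ ^ 2 + 2 * η * a * ⟪G, K⟫ + η ^ 2 * (a / s) ^ 2 * ‖G‖ ^ 2 := by
    rw [norm_add_sq_real, norm_smul, norm_smul, norm_smul, real_inner_smul_left,
      real_inner_smul_right, real_inner_smul_right, real_inner_comm]
    simp only [mul_pow, Real.norm_eq_abs, sq_abs]
    field_simp
  have h3 : η ^ 2 * (a / s) ^ 2 * ‖G‖ ^ 2 ≤ η ^ 2 * ‖G‖ ^ 2 := by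
    have : 0 ≤ η ^ 2 * ‖G‖ ^ 2 := by positivity
    nlinarith
  rw [norm_add_sq_real, h2, norm_smul, mul_pow, Real.norm_eq_abs, sq_abs, real_inner_smul_right,
    inner_add_right, real_inner_smul_right, real_inner_smul_right, real_inner_smul_right,
    real_inner_self_eq_norm_sq, hsq]
  linarith

lemma stability_test
    (hV : Continuous V) (hw : ContDiff ℝ 1 w)
    (hstab : ∀ φ : EuclideanSpace ℝ (Fin N) → ℝ, ContDiff ℝ 1 φ → HasCompactSupport φ →
      0 ≤ ∫ x, (‖gradient φ x‖ ^ 2 - V x * φ x ^ 2))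
    (hweak : ∀ φ : EuclideanSpace ℝ (Fin N) → ℝ, ContDiff ℝ 1 φ → HasCompactSupport φ →
      ∫ x, (⟪gradient w x, gradient φ x⟫ - V x * w x * φ x) = 0)
    {η φ : EuclideanSpace ℝ (Fin N) → ℝ} (hη : ContDiff ℝ 1 η)
    (hηc : HasCompactSupport η) (hφ : ContDiff ℝ 2 φ) (hφc : HasCompactSupport φ) (t : ℝ)
    {ε : ℝ} (hε : 0 < ε) :
    0 ≤ (∫ x, w x ^ 2 * ‖gradient η x‖ ^ 2)
      + ε ^ 2 * (∫ x, (‖gradient η x‖ ^ 2 - V x * η x ^ 2))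
      - 2 * t * (∫ x, √(w x ^ 2 + ε ^ 2) * η x * (coordLaplacian φ x + V x * φ x))
      + t ^ 2 * ∫ x, (‖gradient φ x‖ ^ 2 - V x * φ x ^ 2) := by
  have hpos : ∀ x, 0 < w x ^ 2 + ε ^ 2 := fun x => by positivity
  have hs : ContDiff ℝ 1 fun x => √(w x ^ 2 + ε ^ 2) :=
    ((hw.pow 2).add contDiff_const).sqrt fun x => (hpos x).ne'
  have hφ1 : ContDiff ℝ 1 φ := hφ.of_le one_le_two
  have hsη := hs.mul hη
  have hwη := hw.mul (hη.pow 2)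
  have hwηc : HasCompactSupport fun x => w x * η x ^ 2 :=
    HasCompactSupport.intro hηc fun x hx => by simp [image_eq_zero_of_notMem_tsupport hx]
  have d1 : ∀ {g : EuclideanSpace ℝ (Fin N) → ℝ} (_ : ContDiff ℝ 1 g) (x), DifferentiableAt ℝ g x :=
    fun h => h.differentiable one_ne_zero
  have gs : ∀ x, gradient (fun y => √(w y ^ 2 + ε ^ 2)) x
      = (w x / √(w x ^ 2 + ε ^ 2)) • gradient w x := fun x => by
    refine gradient_comp_deriv (p := fun a => √(a ^ 2 + ε ^ 2)) ?_ (d1 hw x)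
    convert ((hasDerivAt_pow 2 (w x)).add_const (ε ^ 2)).sqrt (hpos x).ne' using 1
    rw [Nat.cast_ofNat, pow_one, mul_div_mul_left _ _ two_ne_zero]
  have gsη : ∀ x, gradient (fun y => √(w y ^ 2 + ε ^ 2) * η y) x = √(w x ^ 2 + ε ^ 2) • gradient η x
      + η x • (w x / √(w x ^ 2 + ε ^ 2)) • gradient w x := fun x => by
    rw [gradient_mul (d1 hs x) (d1 hη x), gs]
  have gwη : ∀ x, gradient (fun y => w y * η y ^ 2) x =
      w x • (2 * η x) • gradient η x + η x ^ 2 • gradient w x := fun x => by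
    have h2 : gradient (fun y => η y ^ 2) x = (2 * η x) • gradient η x := by
      refine gradient_comp_deriv (p := fun a => a ^ 2) ?_ (d1 hη x)
      simpa using hasDerivAt_pow 2 (η x)
    rw [gradient_mul (d1 hw x) (d1 (hη.pow 2) x), h2]
  have i1 : Integrable fun x => w x ^ 2 * ‖gradient η x‖ ^ 2 := by
    have := hη.continuous_gradient
    have := hw.continuous
    exact hηc.integrable_of_eq_zero (by fun_prop) fun x hx => by
      simp [gradient_eq_zero_of_notMem_tsupport hx]
  have i2 := integrable_bilinearForm hV hw hwη hwηc
  have i3 := (integrable_quadraticForm hV hη hηc).const_mul (ε ^ 2)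
  have i4 := (integrable_bilinearForm hV hsη hφ1 hφc).const_mul (2 * t)
  have i5 := (integrable_quadraticForm hV hφ1 hφc).const_mul (t ^ 2)
  have hz : ContDiff ℝ 1 fun x => √(w x ^ 2 + ε ^ 2) * η x + t * φ x :=
    hsη.add (contDiff_const.mul hφ1)
  have hzc : HasCompactSupport fun x => √(w x ^ 2 + ε ^ 2) * η x + t * φ x :=
    (hηc.mul_left (f := fun x => √(w x ^ 2 + ε ^ 2))).add (hφc.mul_left (f := fun _ => t))
  have key := (hstab _ hz hzc).trans (integral_mono (integrable_quadraticForm hV hz hzc)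
    ((((i1.add i2).add i3).add i4).add i5) fun x => ?_)
  · rw [integral_add' (((i1.add i2).add i3).add i4) i5, integral_add' ((i1.add i2).add i3) i4,
      integral_add' (i1.add i2) i3, integral_add' i1 i2, hweak _ hwη hwηc, integral_const_mul,
      integral_const_mul, integral_const_mul, integral_bilinearForm hV hsη hφ hφc] at key
    linarith
  · have hsx : √(w x ^ 2 + ε ^ 2) ≠ 0 := (Real.sqrt_pos.2 (hpos x)).ne'
    have hsq : √(w x ^ 2 + ε ^ 2) ^ 2 = w x ^ 2 + ε ^ 2 := Real.sq_sqrt (hpos x).le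
    have h := norm_sq_add_le_of_sq_le (gradient w x) (gradient η x) (gradient φ x) (η := η x)
      (t := t) hsx hsq
    simp only [Pi.add_apply]
    rw [gradient_add_const_mul t (d1 hsη x) (d1 hφ1 x), gsη, gwη]
    linear_combination h - V x * η x ^ 2 * hsq

lemma abs_mul_cutoff_test
    (hV : Continuous V) (hw : ContDiff ℝ 1 w)
    (hstab : ∀ φ : EuclideanSpace ℝ (Fin N) → ℝ, ContDiff ℝ 1 φ → HasCompactSupport φ →
      0 ≤ ∫ x, (‖gradient φ x‖ ^ 2 - V x * φ x ^ 2))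
    (hweak : ∀ φ : EuclideanSpace ℝ (Fin N) → ℝ, ContDiff ℝ 1 φ → HasCompactSupport φ →
      ∫ x, (⟪gradient w x, gradient φ x⟫ - V x * w x * φ x) = 0)
    {η φ : EuclideanSpace ℝ (Fin N) → ℝ} (hη : ContDiff ℝ 1 η)
    (hηc : HasCompactSupport η) (hφ : ContDiff ℝ 2 φ) (hφc : HasCompactSupport φ) (t : ℝ) :
    0 ≤ (∫ x, w x ^ 2 * ‖gradient η x‖ ^ 2)
      - 2 * t * (∫ x, |w x| * η x * (coordLaplacian φ x + V x * φ x))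
      + t ^ 2 * ∫ x, (‖gradient φ x‖ ^ 2 - V x * φ x ^ 2) := by
  have c1 := hφ.continuous_coordLaplacian
  have c2 := hφ.continuous
  have c3 := hη.continuous
  have c4 := hw.continuous
  have lim : Tendsto (fun ε : ℝ =>
      ∫ x, √(w x ^ 2 + ε ^ 2) * η x * (coordLaplacian φ x + V x * φ x)) (𝓝[>] 0)
      (𝓝 (∫ x, |w x| * η x * (coordLaplacian φ x + V x * φ x))) := by
    refine tendsto_integral_filter_of_dominated_convergence
      (fun x => ‖(|w x| + 1) * η x * (coordLaplacian φ x + V x * φ x)‖) ?_ ?_ ?_ ?_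
    · exact Eventually.of_forall fun ε => Continuous.aestronglyMeasurable (by fun_prop)
    · filter_upwards [Ioo_mem_nhdsGT zero_lt_one] with ε hε
      refine Eventually.of_forall fun x => ?_
      rw [norm_mul, norm_mul, norm_mul, norm_mul]
      gcongr
      rw [Real.norm_of_nonneg (Real.sqrt_nonneg _), Real.norm_of_nonneg (by positivity)]
      refine Real.sqrt_le_iff.2 ⟨by positivity, ?_⟩
      nlinarith [sq_abs (w x), abs_nonneg (w x), hε.1, hε.2]
    · exact (hφc.integrable_of_eq_zero (by fun_prop) fun x hx => by
        simp [coordLaplacian_eq_zero_of_notMem_tsupport hx,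
          image_eq_zero_of_notMem_tsupport hx]).norm
    · refine Eventually.of_forall fun x => tendsto_nhdsWithin_of_tendsto_nhds ?_
      have : Continuous fun ε : ℝ =>
          √(w x ^ 2 + ε ^ 2) * η x * (coordLaplacian φ x + V x * φ x) := by fun_prop
      simpa [Real.sqrt_sq_eq_abs] using this.tendsto 0
  have lim2 : Tendsto (fun ε : ℝ => ε ^ 2) (𝓝[>] 0) (𝓝 0) := by
    refine tendsto_nhdsWithin_of_tendsto_nhds ?_
    simpa using (continuous_pow 2 : Continuous fun ε : ℝ => ε ^ 2).tendsto 0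
  have h := ((((lim2.mul_const (∫ x, (‖gradient η x‖ ^ 2 - V x * η x ^ 2))).const_add
    (∫ x, w x ^ 2 * ‖gradient η x‖ ^ 2)).sub (lim.const_mul (2 * t))).add_const
    (t ^ 2 * ∫ x, (‖gradient φ x‖ ^ 2 - V x * φ x ^ 2)))
  rw [zero_mul, add_zero] at h
  exact ge_of_tendsto h (eventually_mem_nhdsWithin.mono fun ε hε =>
    stability_test hV hw hstab hweak hη hηc hφ hφc t hε)

/-- A solution of the linearized equation with small cutoff energy has modulus solving it too. -/
lemma integral_abs_mul_eq_zero
    (hV : Continuous V) (hw : ContDiff ℝ 1 w)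
    (hstab : ∀ φ : EuclideanSpace ℝ (Fin N) → ℝ, ContDiff ℝ 1 φ → HasCompactSupport φ →
      0 ≤ ∫ x, (‖gradient φ x‖ ^ 2 - V x * φ x ^ 2))
    (hweak : ∀ φ : EuclideanSpace ℝ (Fin N) → ℝ, ContDiff ℝ 1 φ → HasCompactSupport φ →
      ∫ x, (⟪gradient w x, gradient φ x⟫ - V x * w x * φ x) = 0)
    {η : ℕ → EuclideanSpace ℝ (Fin N) → ℝ}
    (hη : ∀ n, ContDiff ℝ 1 (η n)) (hηc : ∀ n, HasCompactSupport (η n))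
    (hη1 : ∀ n x, |η n x| ≤ 1) (hlim : ∀ x, Tendsto (fun n => η n x) atTop (𝓝 1))
    (henergy : Tendsto (fun n => ∫ x, w x ^ 2 * ‖gradient (η n) x‖ ^ 2) atTop (𝓝 0))
    {φ : EuclideanSpace ℝ (Fin N) → ℝ} (hφ : ContDiff ℝ 2 φ) (hφc : HasCompactSupport φ) :
    ∫ x, |w x| * (coordLaplacian φ x + V x * φ x) = 0 := by
  have c1 := hφ.continuous_coordLaplacian
  have c2 := hφ.continuous
  have c3 := fun n => (hη n).continuous
  have c4 := hw.continuous
  have lim : Tendsto (fun n => ∫ x, |w x| * η n x * (coordLaplacian φ x + V x * φ x)) atTop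
      (𝓝 (∫ x, |w x| * (coordLaplacian φ x + V x * φ x))) := by
    refine tendsto_integral_of_dominated_convergence
      (fun x => ‖|w x| * (coordLaplacian φ x + V x * φ x)‖) (fun n => ?_) ?_ (fun n => ?_) ?_
    · have := c3 n
      exact Continuous.aestronglyMeasurable (by fun_prop)
    · exact (hφc.integrable_of_eq_zero (by fun_prop) fun x hx => by
        simp [coordLaplacian_eq_zero_of_notMem_tsupport hx,
          image_eq_zero_of_notMem_tsupport hx]).norm
    · refine Eventually.of_forall fun x => ?_
      rw [norm_mul, norm_mul, norm_mul]
      gcongr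
      exact mul_le_of_le_one_right (norm_nonneg _) (hη1 n x)
    · exact Eventually.of_forall fun x => by
        simpa using ((hlim x).const_mul |w x|).mul_const (coordLaplacian φ x + V x * φ x)
  set L := ∫ x, |w x| * (coordLaplacian φ x + V x * φ x)
  set q := ∫ x, (‖gradient φ x‖ ^ 2 - V x * φ x ^ 2)
  have key : ∀ t : ℝ, 0 ≤ - 2 * t * L + t ^ 2 * q := fun t => by
    have h := (henergy.sub (lim.const_mul (2 * t))).add_const (t ^ 2 * q)
    have := ge_of_tendsto h (Eventually.of_forall fun n =>
      abs_mul_cutoff_test hV hw hstab hweak (hη n) (hηc n) hφ hφc t)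
    linarith
  have hq : 0 ≤ q := hstab φ (hφ.of_le one_le_two) hφc
  have h1 := key (L / (q + 1))
  have h2 : - 2 * (L / (q + 1)) * L + (L / (q + 1)) ^ 2 * q
      = -(L ^ 2 * (q + 2) / (q + 1) ^ 2) := by
    field_simp
    ring
  rw [h2, Left.nonneg_neg_iff] at h1
  by_contra hL
  have : 0 < L ^ 2 * (q + 2) / (q + 1) ^ 2 := by positivity
  linarith

end StableOperator

section Cutoff

lemma hasDerivAt_max_zero_pow (k : ℕ) (s : ℝ) :
    HasDerivAt (fun a : ℝ => max a 0 ^ (k + 2)) ((k + 2) * max s 0 ^ (k + 1)) s := by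
  rcases lt_trichotomy s 0 with hs | rfl | hs
  · rw [max_eq_right hs.le, zero_pow (by simp), mul_zero]
    refine (hasDerivAt_const s (0 : ℝ)).congr_of_eventuallyEq ?_
    filter_upwards [eventually_lt_nhds hs] with a ha
    rw [max_eq_right ha.le, zero_pow (by simp)]
  · rw [hasDerivAt_iff_tendsto_slope_zero]
    have hc : Tendsto (fun a : ℝ => max a 0 ^ (k + 1)) (𝓝[≠] 0) (𝓝 (max 0 0 ^ (k + 1))) :=
      tendsto_nhdsWithin_of_tendsto_nhds
        ((by fun_prop : Continuous fun a : ℝ => max a 0 ^ (k + 1)).tendsto 0)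
    rw [max_self, zero_pow k.succ_ne_zero] at hc
    rw [max_self, zero_pow (k + 1).succ_ne_zero, zero_pow k.succ_ne_zero, mul_zero]
    refine hc.congr' ?_
    filter_upwards [eventually_mem_nhdsWithin] with a ha
    rw [zero_add, sub_zero, smul_eq_mul]
    rcases le_total a 0 with h | h
    · simp [max_eq_right h]
    · rw [max_eq_left h, pow_succ a (k + 1), mul_comm, mul_assoc, mul_inv_cancel₀ ha, mul_one]
  · rw [max_eq_left hs.le]
    have h := hasDerivAt_pow (k + 2) s
    push_cast at h
    refine h.congr_of_eventuallyEq ?_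
    filter_upwards [eventually_gt_nhds hs] with a ha
    rw [max_eq_left ha.le]

lemma contDiff_max_zero_pow (m k : ℕ) (h : m < k) : ContDiff ℝ m fun a : ℝ => max a 0 ^ k := by
  induction m generalizing k with
  | zero => exact contDiff_zero.2 (by fun_prop)
  | succ m ih =>
    obtain ⟨j, rfl⟩ : ∃ j, k = j + 2 := ⟨k - 2, by omega⟩
    have hd : deriv (fun a : ℝ => max a 0 ^ (j + 2)) =
        fun s : ℝ => (j + 2) * max s 0 ^ (j + 1) :=
      funext fun s => (hasDerivAt_max_zero_pow j s).deriv
    rw [Nat.cast_succ, contDiff_succ_iff_deriv]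
    refine ⟨fun s => (hasDerivAt_max_zero_pow j s).differentiableAt, by simp, ?_⟩
    rw [hd]
    exact contDiff_const.mul (ih (j + 1) (by omega))

variable {N : ℕ}

/-- The compactly supported paraboloid `(a - b |x - c|²)₊ ^ k`. -/
noncomputable def paraboloidPow (a b : ℝ) (c : EuclideanSpace ℝ (Fin N)) (k : ℕ)
    (x : EuclideanSpace ℝ (Fin N)) : ℝ :=
  max (a - b * ‖x - c‖ ^ 2) 0 ^ k

variable (a b : ℝ) (c : EuclideanSpace ℝ (Fin N))

lemma paraboloidPow_nonneg (k : ℕ) (x : EuclideanSpace ℝ (Fin N)) :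
    0 ≤ paraboloidPow a b c k x :=
  pow_nonneg (le_max_right _ _) _

variable {b} in
lemma hasCompactSupport_paraboloidPow (hb : 0 < b) (k : ℕ) :
    HasCompactSupport (paraboloidPow a b c (k + 1)) := by
  refine HasCompactSupport.intro (isCompact_closedBall c √(a / b)) fun x hx => ?_
  rw [Metric.mem_closedBall, not_le, dist_eq_norm] at hx
  have h : a / b < ‖x - c‖ ^ 2 := Real.lt_sq_of_sqrt_lt hx
  rw [div_lt_iff₀ hb] at h
  rw [paraboloidPow, max_eq_right (by linarith), zero_pow (by simp)]

lemma contDiff_paraboloidPow {m k : ℕ} (h : m < k) : ContDiff ℝ m (paraboloidPow a b c k) :=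
  (contDiff_max_zero_pow m k h).comp (g := fun a : ℝ => max a 0 ^ k)
    (contDiff_const.sub (contDiff_const.mul ((contDiff_id.sub contDiff_const).norm_sq ℝ)))

lemma hasFDerivAt_paraboloidPow (k : ℕ) (x : EuclideanSpace ℝ (Fin N)) :
    HasFDerivAt (paraboloidPow a b c (k + 2))
      (((k + 2) * paraboloidPow a b c (k + 1) x * (-2 * b)) • innerSL ℝ (x - c)) x := by
  have h2 : HasFDerivAt (fun y : EuclideanSpace ℝ (Fin N) => ‖y - c‖ ^ 2)
      ((2 : ℝ) • innerSL ℝ (x - c)) x := by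
    refine ((hasStrictFDerivAt_norm_sq (x - c)).hasFDerivAt.comp x
      ((hasFDerivAt_id x).sub_const c)).congr_fderiv ?_
    ext y
    simp
  refine ((hasDerivAt_max_zero_pow k _).comp_hasFDerivAt x
    ((h2.const_mul b).const_sub a)).congr_fderiv ?_
  ext y
  simp [paraboloidPow]
  ring

lemma gradient_paraboloidPow (k : ℕ) (x : EuclideanSpace ℝ (Fin N)) :
    gradient (paraboloidPow a b c (k + 2)) x =
      ((k + 2) * paraboloidPow a b c (k + 1) x * (-2 * b)) • (x - c) :=
  (hasFDerivAt_paraboloidPow a b c k x).gradient_eq_of_forall_inner fun y => by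
    rw [real_inner_smul_left]
    rfl

lemma coordLaplacian_paraboloidPow (k : ℕ) (x : EuclideanSpace ℝ (Fin N)) :
    coordLaplacian (paraboloidPow a b c (k + 3)) x =
      4 * b ^ 2 * (k + 3) * (k + 2) * paraboloidPow a b c (k + 1) x * ‖x - c‖ ^ 2
        - 2 * b * N * (k + 3) * paraboloidPow a b c (k + 2) x := by
  have h1 : ∀ i : Fin N, (fun y => fderiv ℝ (paraboloidPow a b c (k + 3)) y
      (EuclideanSpace.single i 1)) =
        fun y => (-2 * b * (k + 3)) * (paraboloidPow a b c (k + 2) y * (y i - c i)) := fun i => by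
    ext y
    rw [(hasFDerivAt_paraboloidPow a b c (k + 1) y).fderiv]
    simp [EuclideanSpace.inner_single_right]
    ring
  have h2 : ∀ i : Fin N, HasFDerivAt (fun y : EuclideanSpace ℝ (Fin N) => y i - c i)
      (EuclideanSpace.proj i : EuclideanSpace ℝ (Fin N) →L[ℝ] ℝ) x := fun i =>
    (EuclideanSpace.proj i : EuclideanSpace ℝ (Fin N) →L[ℝ] ℝ).hasFDerivAt.sub_const _
  have h3 : ∀ i : Fin N, fderiv ℝ (fun y => fderiv ℝ (paraboloidPow a b c (k + 3)) y
      (EuclideanSpace.single i 1)) x (EuclideanSpace.single i 1) =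
        4 * b ^ 2 * (k + 3) * (k + 2) * paraboloidPow a b c (k + 1) x * (x i - c i) ^ 2
        - 2 * b * (k + 3) * paraboloidPow a b c (k + 2) x := fun i => by
    have h4 := ((hasFDerivAt_paraboloidPow a b c k x).mul (h2 i)).const_mul (-2 * b * (k + 3))
    simp only [Pi.mul_apply] at h4
    rw [h1, h4.fderiv]
    simp [EuclideanSpace.inner_single_right]
    ring
  rw [coordLaplacian, Finset.sum_congr rfl fun i _ => h3 i, Finset.sum_sub_distrib,
    ← Finset.mul_sum, EuclideanSpace.real_norm_sq_eq]
  simp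
  ring

end Cutoff

section UniqueContinuation

variable {N : ℕ} {V v w : EuclideanSpace ℝ (Fin N) → ℝ} {M : ℝ}

/-- A nonnegative distributional solution of `Δv + V v = 0` vanishing on a ball vanishes
identically. -/
lemma eq_zero_of_nonneg_of_eq_zero_on_ball (hV : Continuous V) (hM : ∀ x, -M ≤ V x)
    (hv : Continuous v) (hv0 : ∀ x, 0 ≤ v x)
    (h : ∀ φ : EuclideanSpace ℝ (Fin N) → ℝ, ContDiff ℝ 2 φ → HasCompactSupport φ →
      ∫ x, v x * (coordLaplacian φ x + V x * φ x) = 0)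
    {x₀ : EuclideanSpace ℝ (Fin N)} {r : ℝ} (hr : 0 < r)
    (hball : ∀ x, ‖x - x₀‖ < r → v x = 0) (y : EuclideanSpace ℝ (Fin N)) : v y = 0 := by
  set R := ‖y - x₀‖ + 1
  have hR : 0 < R := by positivity
  obtain ⟨k, hk⟩ := exists_nat_gt ((|M| * R ^ 4 + 2 * N * R ^ 2) / (4 * r ^ 2))
  rw [div_lt_iff₀ (by positivity)] at hk
  have hφ : ContDiff ℝ 2 (paraboloidPow (R ^ 2) 1 x₀ (k + 3)) :=
    contDiff_paraboloidPow (m := 2) _ _ _ (by omega)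
  have hφc := hasCompactSupport_paraboloidPow (R ^ 2) x₀ one_pos (k + 2)
  have c1 := hφ.continuous_coordLaplacian
  have c2 := hφ.continuous
  set g := fun x => coordLaplacian (paraboloidPow (R ^ 2) 1 x₀ (k + 3)) x
    + V x * paraboloidPow (R ^ 2) 1 x₀ (k + 3) x
  have hpos : ∀ x, r ≤ ‖x - x₀‖ → ‖x - x₀‖ < R → 0 < g x := fun x h1 h2 => by
    have hs : 0 < R ^ 2 - ‖x - x₀‖ ^ 2 := by nlinarith [norm_nonneg (x - x₀)]
    simp only [g, coordLaplacian_paraboloidPow, paraboloidPow, one_mul, max_eq_left hs.le]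
    have hsR : R ^ 2 - ‖x - x₀‖ ^ 2 ≤ R ^ 2 := by nlinarith [norm_nonneg (x - x₀)]
    have hrx : r ^ 2 ≤ ‖x - x₀‖ ^ 2 := by gcongr
    set s := R ^ 2 - ‖x - x₀‖ ^ 2
    set d := ‖x - x₀‖ ^ 2
    have hs2 : s ^ 2 ≤ R ^ 4 := by nlinarith
    have hVM : -|M| * R ^ 4 ≤ V x * s ^ 2 := by
      have := (neg_le_neg (le_abs_self M)).trans (hM x)
      nlinarith [abs_nonneg M, sq_nonneg s]
    have e1 : (N : ℝ) * s ≤ N * R ^ 2 := by gcongr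
    have e2 : (k : ℝ) * r ^ 2 ≤ k * d := by gcongr
    have hd : 0 ≤ d := by positivity
    have e3 : |M| * R ^ 4 < 4 * (k + 2) * d - 2 * N * s := by nlinarith
    have hMR : 0 ≤ |M| * R ^ 4 := by positivity
    have e4 : 0 < (k + 3) * (4 * (k + 2) * d - 2 * N * s) + V x * s ^ 2 := by
      have : 0 ≤ (k + 2 : ℝ) * (4 * (k + 2) * d - 2 * N * s) :=
        mul_nonneg (by positivity) (by linarith)
      linarith
    have e5 := mul_pos (pow_pos hs (k + 1)) e4
    refine e5.trans_eq ?_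
    ring
  have hzero : ∀ x, R ≤ ‖x - x₀‖ → g x = 0 := fun x h2 => by
    have hs : R ^ 2 - ‖x - x₀‖ ^ 2 ≤ 0 := by nlinarith
    simp [g, coordLaplacian_paraboloidPow, paraboloidPow, max_eq_right hs]
  have hnn : ∀ x, 0 ≤ v x * g x := fun x => by
    rcases lt_or_ge ‖x - x₀‖ r with h1 | h1
    · simp [hball x h1]
    · rcases lt_or_ge ‖x - x₀‖ R with h2 | h2
      · exact mul_nonneg (hv0 x) (hpos x h1 h2).le
      · simp [hzero x h2]
  have hcont : Continuous fun x => v x * g x := by fun_prop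
  have hint : Integrable fun x => v x * g x := hφc.integrable_of_eq_zero hcont fun x hx => by
    simp [g, coordLaplacian_eq_zero_of_notMem_tsupport hx, image_eq_zero_of_notMem_tsupport hx]
  have hae := (integral_eq_zero_iff_of_nonneg hnn hint).1 (h _ hφ hφc)
  have heq := congr_fun ((hcont.ae_eq_iff_eq volume continuous_const).1 hae) y
  rcases lt_or_ge ‖y - x₀‖ r with h1 | h1
  · exact hball y h1
  · exact (mul_eq_zero.1 heq).resolve_right (hpos y h1 (lt_add_one _)).ne'

/-- If both `w` and `|w|` are distributional solutions of `Δw + V w = 0`, then `w` has a sign. -/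
lemma nonneg_or_nonpos_of_integral_abs (hV : Continuous V) (hM : ∀ x, -M ≤ V x)
    (hw : Continuous w)
    (h : ∀ φ : EuclideanSpace ℝ (Fin N) → ℝ, ContDiff ℝ 2 φ → HasCompactSupport φ →
      ∫ x, w x * (coordLaplacian φ x + V x * φ x) = 0)
    (habs : ∀ φ : EuclideanSpace ℝ (Fin N) → ℝ, ContDiff ℝ 2 φ → HasCompactSupport φ →
      ∫ x, |w x| * (coordLaplacian φ x + V x * φ x) = 0) :
    (∀ x, 0 ≤ w x) ∨ ∀ x, w x ≤ 0 := by
  by_contra! hcon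
  obtain ⟨⟨x₀, hx₀⟩, y, hy⟩ := hcon
  obtain ⟨r, hr, hball⟩ := Metric.eventually_nhds_iff.1
    (hw.continuousAt.eventually_lt continuousAt_const hx₀)
  refine absurd (eq_zero_of_nonneg_of_eq_zero_on_ball hV hM
    (hw.abs.add hw : Continuous fun x => |w x| + w x)
    (fun x => neg_le_iff_add_nonneg.1 (neg_abs_le (w x)) |>.trans_eq (add_comm _ _))
    (fun φ hφ hφc => ?_) hr (x₀ := x₀) (fun x hx => ?_) y) ?_
  · have c1 := hφ.continuous_coordLaplacian
    have c2 := hφ.continuous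
    have i : ∀ v : EuclideanSpace ℝ (Fin N) → ℝ, Continuous v →
        Integrable fun x => v x * (coordLaplacian φ x + V x * φ x) := fun v hv =>
      hφc.integrable_of_eq_zero (by fun_prop) fun x hx => by
        simp [coordLaplacian_eq_zero_of_notMem_tsupport hx, image_eq_zero_of_notMem_tsupport hx]
    refine (integral_congr_ae (Eventually.of_forall fun x => add_mul |w x| (w x) _)).trans ?_
    rw [integral_add (i _ hw.abs) (i _ hw), h φ hφ hφc, habs φ hφ hφc, add_zero]
  · have := hball (y := x) (by rwa [dist_eq_norm])
    show |w x| + w x = 0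
    rw [abs_of_neg this, neg_add_cancel]
  · have := abs_pos.2 hy.ne'
    exact (by linarith : (0 : ℝ) < |w y| + w y).ne'

end UniqueContinuation


section Energy

variable {N : ℕ} {u : EuclideanSpace ℝ (Fin N) → ℝ}

lemma paraboloidPow_le_one {b : ℝ} (hb : 0 ≤ b) (c : EuclideanSpace ℝ (Fin N)) (k : ℕ)
    (x : EuclideanSpace ℝ (Fin N)) : paraboloidPow 1 b c k x ≤ 1 :=
  pow_le_one₀ (le_max_right _ _)
    (max_le (sub_le_self _ (mul_nonneg hb (sq_nonneg _))) zero_le_one)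

lemma paraboloidPow_eq_zero {R : ℝ} (hR : 0 < R) {x : EuclideanSpace ℝ (Fin N)} (hx : R < ‖x‖)
    (k : ℕ) : paraboloidPow 1 (1 / R ^ 2) 0 (k + 1) x = 0 := by
  have h : 1 - 1 / R ^ 2 * ‖x‖ ^ 2 ≤ 0 := by
    rw [sub_nonpos, one_div_mul_eq_div, one_le_div (by positivity)]
    gcongr
  rw [paraboloidPow, sub_zero, max_eq_right h, zero_pow (by simp)]

lemma norm_gradient_paraboloidPow_sq_le {R : ℝ} (hR : 0 < R) (k : ℕ)
    (x : EuclideanSpace ℝ (Fin N)) :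
    ‖gradient (paraboloidPow 1 (1 / R ^ 2) 0 (k + 2)) x‖ ^ 2 ≤
      4 * (k + 2) ^ 2 / R ^ 2 * paraboloidPow 1 (1 / R ^ 2) 0 (k + 1) x ^ 2 := by
  rw [gradient_paraboloidPow, sub_zero, norm_smul, mul_pow, Real.norm_eq_abs, sq_abs]
  rcases lt_or_ge R ‖x‖ with h | h
  · rw [paraboloidPow_eq_zero hR h]
    simp
  · calc ((k + 2) * paraboloidPow 1 (1 / R ^ 2) 0 (k + 1) x * (-2 * (1 / R ^ 2))) ^ 2 * ‖x‖ ^ 2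
        ≤ ((k + 2) * paraboloidPow 1 (1 / R ^ 2) 0 (k + 1) x * (-2 * (1 / R ^ 2))) ^ 2 * R ^ 2 := by
          gcongr
      _ = _ := by field_simp; ring

lemma pow_mul_le_pow_succ_add_pow_succ {X b : ℝ} (hX : 0 ≤ X) (hb : 0 ≤ b) (j : ℕ) :
    X ^ j * b ≤ X ^ (j + 1) + b ^ (j + 1) := by
  rcases le_total X b with h | h
  · calc X ^ j * b ≤ b ^ j * b := by gcongr
      _ = b ^ (j + 1) := (pow_succ b j).symm
      _ ≤ _ := le_add_of_nonneg_left (by positivity)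
  · calc X ^ j * b ≤ X ^ j * X := by gcongr
      _ = X ^ (j + 1) := (pow_succ X j).symm
      _ ≤ _ := le_add_of_nonneg_right (by positivity)

/-- A Caccioppoli inequality for bounded functions satisfying `u Δu ≥ c u² - g`. -/
lemma exists_forall_integral_cutoff_le {c U : ℝ} {g : EuclideanSpace ℝ (Fin N) → ℝ}
    (hu : ContDiff ℝ 2 u) (hc : 0 < c) (hU : ∀ x, u x ^ 2 ≤ U) (hg : Integrable g)
    (hg0 : ∀ x, 0 ≤ g x) (h : ∀ x, c * u x ^ 2 - g x ≤ u x * coordLaplacian u x) :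
    ∃ C, ∀ R : ℝ, 1 ≤ R →
      ∫ x, paraboloidPow 1 (1 / R ^ 2) 0 (N + 2) x ^ 2 * ‖gradient u x‖ ^ 2 ≤ C := by
  have hU0 : 0 ≤ U := (sq_nonneg _).trans (hU 0)
  let B : ℝ := volume.real (Metric.closedBall (0 : EuclideanSpace ℝ (Fin N)) 1)
  let a : ℝ := 8 * (N + 2) ^ 2 / c
  refine ⟨2 * ((∫ x, g x) + c * U * a ^ (N + 2) * B), fun R hR => ?_⟩
  have hR0 : 0 < R := one_pos.trans_le hR
  set χ := paraboloidPow 1 (1 / R ^ 2) (0 : EuclideanSpace ℝ (Fin N)) (N + 2) with hχdef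
  have hχ : ContDiff ℝ 1 χ := contDiff_paraboloidPow (m := 1) _ _ _ (by omega)
  have hχc : HasCompactSupport χ :=
    hasCompactSupport_paraboloidPow _ _ (by positivity) (N + 1)
  have hu1 := hu.of_le one_le_two
  have hφ : ContDiff ℝ 1 fun x => u x * χ x ^ 2 := hu1.mul (hχ.pow 2)
  have hφc : HasCompactSupport fun x => u x * χ x ^ 2 :=
    HasCompactSupport.intro hχc fun x hx => by simp [image_eq_zero_of_notMem_tsupport hx]
  have d1 : ∀ {g : EuclideanSpace ℝ (Fin N) → ℝ} (_ : ContDiff ℝ 1 g) (x), DifferentiableAt ℝ g x :=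
    fun h => h.differentiable one_ne_zero
  have hgrad : ∀ x, gradient (fun y => u y * χ y ^ 2) x =
      u x • (2 * χ x) • gradient χ x + χ x ^ 2 • gradient u x := fun x => by
    have h2 : gradient (fun y => χ y ^ 2) x = (2 * χ x) • gradient χ x := by
      refine gradient_comp_deriv (p := fun a => a ^ 2) ?_ (d1 hχ x)
      simpa using hasDerivAt_pow 2 (χ x)
    rw [gradient_mul (d1 hu1 x) (d1 (hχ.pow 2) x), h2]
  have c1 := hφ.continuous_gradient
  have c2 := hu1.continuous_gradient
  have c3 := hu.continuous_coordLaplacian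
  have c4 := hφ.continuous
  have c5 := hχ.continuous
  have i1 : Integrable fun x => ⟪gradient (fun y => u y * χ y ^ 2) x, gradient u x⟫ :=
    hφc.integrable_of_eq_zero (by fun_prop) fun x hx => by
      simp [gradient_eq_zero_of_notMem_tsupport hx]
  have i2 : Integrable fun x => u x * χ x ^ 2 * coordLaplacian u x :=
    hφc.integrable_of_eq_zero (by fun_prop) fun x hx => by
      simp only [image_eq_zero_of_notMem_tsupport hx, zero_mul]
  have i3 : Integrable fun x => 1 / 2 * (χ x ^ 2 * ‖gradient u x‖ ^ 2) :=
    hχc.integrable_of_eq_zero (by fun_prop) fun x hx => by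
      simp [image_eq_zero_of_notMem_tsupport hx]
  have i4 : Integrable ((Metric.closedBall (0 : EuclideanSpace ℝ (Fin N)) R).indicator
      fun _ => c * U * (a / R ^ 2) ^ (N + 2)) := by
    rw [integrable_indicator_iff measurableSet_closedBall]
    exact integrableOn_const measure_closedBall_lt_top.ne
  have hvol : ∫ x, (Metric.closedBall (0 : EuclideanSpace ℝ (Fin N)) R).indicator
      (fun _ => c * U * (a / R ^ 2) ^ (N + 2)) x ≤ c * U * a ^ (N + 2) * B := by
    rw [integral_indicator measurableSet_closedBall, setIntegral_const, smul_eq_mul,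
      Measure.addHaar_real_closedBall' _ _ hR0.le, finrank_euclideanSpace_fin]
    have hp : R ^ N ≤ (R ^ 2) ^ (N + 2) := by
      rw [← pow_mul]
      exact pow_le_pow_right₀ hR (by omega)
    have hB : 0 ≤ B := measureReal_nonneg
    have ha : 0 ≤ a := by positivity
    rw [div_pow]
    calc R ^ N * B * (c * U * (a ^ (N + 2) / (R ^ 2) ^ (N + 2)))
        = R ^ N / (R ^ 2) ^ (N + 2) * (c * U * a ^ (N + 2) * B) := by ring
      _ ≤ 1 * (c * U * a ^ (N + 2) * B) := by
          gcongr
          exact (div_le_one (by positivity)).2 hp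
      _ = _ := one_mul _
  have key := integral_mono i3 (((i1.add i2).add hg).add i4) fun x => ?_
  · rw [integral_const_mul, integral_add' ((i1.add i2).add hg) i4, integral_add' (i1.add i2) hg,
      integral_add' i1 i2,
      integral_inner_gradient_eq_neg_integral_mul_coordLaplacian hφ hu (Or.inl hφc)] at key
    linarith
  · simp only [Pi.add_apply]
    have hχ1 : χ x ^ 2 ≤ 1 :=
      pow_le_one₀ (paraboloidPow_nonneg _ _ _ _ _) (paraboloidPow_le_one (by positivity) _ _ _)
    have e1 : ⟪gradient (fun y => u y * χ y ^ 2) x, gradient u x⟫ =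
        2 * ⟪u x • gradient χ x, χ x • gradient u x⟫ + χ x ^ 2 * ‖gradient u x‖ ^ 2 := by
      rw [hgrad, inner_add_left]
      simp only [real_inner_smul_left, real_inner_smul_right, real_inner_self_eq_norm_sq]
      ring
    have e2 : 0 ≤ 2 * u x ^ 2 * ‖gradient χ x‖ ^ 2 + 2 * ⟪u x • gradient χ x, χ x • gradient u x⟫
        + 1 / 2 * (χ x ^ 2 * ‖gradient u x‖ ^ 2) := by
      have := norm_add_sq_real ((2 : ℝ) • u x • gradient χ x) (χ x • gradient u x)
      rw [real_inner_smul_left, norm_smul, norm_smul, norm_smul, mul_pow, mul_pow, mul_pow] at this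
      simp only [Real.norm_eq_abs, sq_abs] at this
      linarith [sq_nonneg ‖(2 : ℝ) • u x • gradient χ x + χ x • gradient u x‖]
    have e3 : 2 * u x ^ 2 * ‖gradient χ x‖ ^ 2 ≤ c * u x ^ 2 * χ x ^ 2 +
        (Metric.closedBall (0 : EuclideanSpace ℝ (Fin N)) R).indicator
          (fun _ => c * U * (a / R ^ 2) ^ (N + 2)) x := by
      have hn := norm_gradient_paraboloidPow_sq_le hR0 N x
      rcases lt_or_ge R ‖x‖ with hx | hx
      · rw [paraboloidPow_eq_zero hR0 hx, ← hχdef] at hn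
        have hn0 : ‖gradient χ x‖ ^ 2 ≤ 0 := by linarith
        have hi : (0 : ℝ) ≤ (Metric.closedBall (0 : EuclideanSpace ℝ (Fin N)) R).indicator
          (fun _ => c * U * (a / R ^ 2) ^ (N + 2)) x :=
          Set.indicator_nonneg (fun _ _ => by positivity) x
        have : 2 * u x ^ 2 * ‖gradient χ x‖ ^ 2 ≤ 0 :=
          mul_nonpos_of_nonneg_of_nonpos (by positivity) hn0
        have : 0 ≤ c * u x ^ 2 * χ x ^ 2 := by positivity
        linarith
      · rw [Set.indicator_of_mem (by simpa using hx)]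
        set p := max (1 - 1 / R ^ 2 * ‖x - 0‖ ^ 2) 0
        have hp := pow_mul_le_pow_succ_add_pow_succ (sq_nonneg p)
          (by positivity : 0 ≤ a / R ^ 2) (N + 1)
        have hχx : χ x ^ 2 = (p ^ 2) ^ (N + 1 + 1) := by
          rw [← pow_mul, mul_comm, pow_mul]; rfl
        have hn' : ‖gradient χ x‖ ^ 2 ≤ 4 * (N + 2) ^ 2 / R ^ 2 * (p ^ 2) ^ (N + 1) := by
          rw [← pow_mul p, mul_comm 2, pow_mul]; exact hn
        rw [hχx]
        calc 2 * u x ^ 2 * ‖gradient χ x‖ ^ 2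
            ≤ 2 * u x ^ 2 * (4 * (N + 2) ^ 2 / R ^ 2 * (p ^ 2) ^ (N + 1)) := by gcongr
          _ = c * u x ^ 2 * ((p ^ 2) ^ (N + 1) * (a / R ^ 2)) := by
              simp only [a]; field_simp; ring
          _ ≤ c * u x ^ 2 * ((p ^ 2) ^ (N + 1 + 1) + (a / R ^ 2) ^ (N + 1 + 1)) := by gcongr
          _ = c * u x ^ 2 * (p ^ 2) ^ (N + 1 + 1) + c * u x ^ 2 * (a / R ^ 2) ^ (N + 2) :=
              mul_add _ _ _
          _ ≤ _ := by
              gcongr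
              exact hU x
    have e4 := mul_le_mul_of_nonneg_left (h x) (sq_nonneg (χ x))
    have e5 : χ x ^ 2 * g x ≤ g x := mul_le_of_le_one_left (hg0 x) hχ1
    rw [e1]
    linarith

end Energy

section LocalizedSolutions

variable {N : ℕ} {f : ℝ → ℝ} {u : EuclideanSpace ℝ (Fin N) → ℝ}

lemma fderiv_coordLaplacian_apply {φ : EuclideanSpace ℝ (Fin N) → ℝ} (hφ : ContDiff ℝ 3 φ)
    (v x : EuclideanSpace ℝ (Fin N)) :
    fderiv ℝ (coordLaplacian φ) x v = coordLaplacian (fun y => fderiv ℝ φ y v) x := by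
  have h2 : ∀ w : EuclideanSpace ℝ (Fin N), ContDiff ℝ 2 fun y => fderiv ℝ φ y w := fun w =>
    hφ.fderiv_apply_const (m := 2) (by norm_num) w
  have hd : ∀ i : Fin N, DifferentiableAt ℝ (fun y => fderiv ℝ (fun z => fderiv ℝ φ z
      (EuclideanSpace.single i 1)) y (EuclideanSpace.single i 1)) x := fun i =>
    ((h2 _).fderiv_apply_const (m := 1) le_rfl _).differentiable one_ne_zero x
  have hL : coordLaplacian φ = fun y => ∑ i : Fin N, fderiv ℝ (fun z => fderiv ℝ φ z
      (EuclideanSpace.single i 1)) y (EuclideanSpace.single i 1) := rfl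
  rw [hL, fderiv_fun_sum fun i _ => hd i, sum_apply, coordLaplacian]
  refine Finset.sum_congr rfl fun i _ => ?_
  rw [fderiv_fderiv_apply_comm (h2 _)]
  congr 2
  ext y
  exact fderiv_fderiv_apply_comm (hφ.of_le (by norm_num)) _ _ _

/-- Directional derivatives of a solution solve the linearized equation. -/
lemma integral_linearized_eq_zero (hf : ContDiff ℝ 1 f) (hu : ContDiff ℝ 2 u)
    (heq : ∀ x, coordLaplacian u x + f (u x) = 0) (v : EuclideanSpace ℝ (Fin N))
    {φ : EuclideanSpace ℝ (Fin N) → ℝ} (hφ : ContDiff ℝ 1 φ) (hc : HasCompactSupport φ) :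
    ∫ x, (⟪gradient (fun y => fderiv ℝ u y v) x, gradient φ x⟫
      - deriv f (u x) * fderiv ℝ u x v * φ x) = 0 := by
  have hw : ContDiff ℝ 1 fun y => fderiv ℝ u y v := hu.fderiv_apply_const le_rfl v
  have c1 := hw.continuous_gradient
  have c2 := hw.continuous
  have c3 := hu.continuous
  have c4 : Continuous (deriv f) := hf.continuous_deriv le_rfl
  have cV : Continuous fun x => deriv f (u x) := c4.comp c3
  obtain ⟨ψ, hψ, hψc, hlim⟩ := exists_smooth_tendsto_integral (μ := volume) hφ hc
  have hl := hlim (fun x a b => ⟪gradient (fun y => fderiv ℝ u y v) x, b⟫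
      - deriv f (u x) * fderiv ℝ u x v * a) (by fun_prop) (by simp)
  refine tendsto_nhds_unique hl (tendsto_const_nhds.congr fun n => Eq.symm ?_)
  have hψ3 : ContDiff ℝ 3 (ψ n) := by
    exact_mod_cast contDiff_infty.1 (hψ n) 3
  have hψ2 : ContDiff ℝ 2 (ψ n) := hψ3.of_le (by norm_num)
  have hψ1 : ContDiff ℝ 1 (ψ n) := hψ3.of_le (by norm_num)
  have hψv : ContDiff ℝ 2 fun y => fderiv ℝ (ψ n) y v := hψ3.fderiv_apply_const (by norm_num) v
  have hψvc : HasCompactSupport fun y => fderiv ℝ (ψ n) y v := (hψc n).fderiv_apply ℝ v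
  have hL : ContDiff ℝ 1 (coordLaplacian (ψ n)) := ContDiff.sum fun i _ =>
    (hψ3.fderiv_apply_const (m := 2) (by norm_num) _).fderiv_apply_const le_rfl _
  have hLc : HasCompactSupport (coordLaplacian (ψ n)) :=
    HasCompactSupport.intro (hψc n) fun x hx => coordLaplacian_eq_zero_of_notMem_tsupport hx
  have hfu : ContDiff ℝ 1 fun x => f (u x) := hf.comp (hu.of_le one_le_two)
  have hfu' : ∀ x, fderiv ℝ (fun y => f (u y)) x v = deriv f (u x) * fderiv ℝ u x v := fun x => by
    have h : HasFDerivAt (fun y => f (u y)) (deriv f (u x) • fderiv ℝ u x) x :=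
      (hf.differentiable one_ne_zero (u x)).hasDerivAt.comp_hasFDerivAt x
        (hu.differentiable two_ne_zero x).hasFDerivAt
    rw [h.fderiv]
    rfl
  have e1 : ∫ x, coordLaplacian (ψ n) x * fderiv ℝ u x v =
      ∫ x, ψ n x * (-(deriv f (u x) * fderiv ℝ u x v)) := by
    have hsymm := integral_inner_gradient_eq_neg_integral_mul_coordLaplacian
      (hu.of_le one_le_two) hψv (Or.inr hψvc)
    simp_rw [real_inner_comm (gradient (fun y => fderiv ℝ (ψ n) y v) _)] at hsymm
    rw [integral_inner_gradient_eq_neg_integral_mul_coordLaplacian (hψv.of_le one_le_two) hu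
      (Or.inl hψvc)] at hsymm
    have hp := integral_mul_fderiv_eq_neg_of_hasCompactSupport hψ1 hfu (Or.inl (hψc n)) v
    have hΔ : ∀ x, coordLaplacian u x = -f (u x) := fun x => eq_neg_of_add_eq_zero_left (heq x)
    simp_rw [hΔ, mul_neg, integral_neg] at hsymm
    rw [integral_mul_fderiv_eq_neg_of_hasCompactSupport hL (hu.of_le one_le_two) (Or.inl hLc)]
    simp_rw [fderiv_coordLaplacian_apply hψ3, mul_neg, integral_neg, ← hfu', hp]
    simp_rw [mul_comm (coordLaplacian _ _)]
    linarith
  have i1 : Integrable fun x => coordLaplacian (ψ n) x * fderiv ℝ u x v :=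
    hLc.integrable_of_eq_zero (hL.continuous.mul c2) fun x hx => by
      simp [image_eq_zero_of_notMem_tsupport hx]
  have cψ := hψ1.continuous
  have i2 : Integrable fun x => ψ n x * (-(deriv f (u x) * fderiv ℝ u x v)) :=
    (hψc n).integrable_of_eq_zero (by fun_prop) fun x hx => by
      simp [image_eq_zero_of_notMem_tsupport hx]
  rw [integral_bilinearForm cV hw hψ2 (hψc n), neg_eq_zero]
  rw [← sub_eq_zero, ← integral_sub i1 i2] at e1
  rw [← e1]
  congr 1 with x
  ring

lemma eq_zero_of_forall_fderiv_nonneg {E : Type*} [NormedAddCommGroup E] [NormedSpace ℝ E]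
    [ProperSpace E] {u : E → ℝ} (hu : Differentiable ℝ u) (hloc : Tendsto u (cocompact E) (𝓝 0))
    {v : E} (hv : v ≠ 0) (h : ∀ x, 0 ≤ fderiv ℝ u x v) (x : E) : u x = 0 := by
  have hd : ∀ t : ℝ, HasDerivAt (fun t : ℝ => u (x + t • v)) (fderiv ℝ u (x + t • v) v) t :=
    fun t => by
      have h1 : HasDerivAt (fun t : ℝ => x + t • v) v t := by
        simpa using ((hasDerivAt_id t).smul_const v).const_add x
      exact (hu _).hasFDerivAt.comp_hasDerivAt t h1
  have hmono : Monotone fun t : ℝ => u (x + t • v) :=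
    monotone_of_deriv_nonneg (fun t => (hd t).differentiableAt) fun t => (hd t).deriv ▸ h _
  have hlim : Tendsto (fun t : ℝ => u (x + t • v)) (cocompact ℝ) (𝓝 0) :=
    hloc.comp (((Homeomorph.addLeft x).isClosedEmbedding.comp
      (isClosedEmbedding_smul_left hv)).tendsto_cocompact)
  refine le_antisymm ?_ ?_
  · simpa using hmono.ge_of_tendsto (hlim.mono_left atTop_le_cocompact) 0
  · simpa using hmono.le_of_tendsto (hlim.mono_left atBot_le_cocompact) 0

lemma hasCompactSupport_max_zero {c : ℝ} (hf : DifferentiableAt ℝ f 0) (hf0 : f 0 = 0)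
    (hc : 0 < c) (hf' : deriv f 0 = -(2 * c))
    (hloc : Tendsto u (cocompact (EuclideanSpace ℝ (Fin N))) (𝓝 0)) :
    HasCompactSupport fun x => max 0 (c * u x ^ 2 + u x * f (u x)) := by
  rw [hasCompactSupport_iff_eventuallyEq, coclosedCompact_eq_cocompact]
  have h := hf.hasDerivAt.isLittleO.def hc
  filter_upwards [hloc.eventually h] with x hx
  rw [hf0, hf', sub_zero, sub_zero, smul_eq_mul, Real.norm_eq_abs, Real.norm_eq_abs] at hx
  refine max_eq_left ?_
  have h1 : u x * (f (u x) - u x * -(2 * c)) ≤ |u x| * (c * |u x|) :=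
    (le_abs_self _).trans (by rw [abs_mul]; gcongr)
  nlinarith [abs_mul_abs_self (u x)]

end LocalizedSolutions

theorem stmt_3 {N : ℕ} (hN : 1 ≤ N) (f : ℝ → ℝ) (hf : ContDiff ℝ 1 f) (hf0 : f 0 = 0)
    (hf'0 : deriv f 0 < 0)
    (u : EuclideanSpace ℝ (Fin N) → ℝ) (hu : ContDiff ℝ 2 u)
    (heq : ∀ x, coordLaplacian u x + f (u x) = 0)
    (hloc : Tendsto u (cocompact (EuclideanSpace ℝ (Fin N))) (nhds 0))
    (hstab : ∀ φ : EuclideanSpace ℝ (Fin N) → ℝ, ContDiff ℝ (⊤ : ℕ∞) φ → HasCompactSupport φ →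
      0 ≤ ∫ x, (‖gradient φ x‖ ^ 2 - deriv f (u x) * (φ x) ^ 2)) :
    ∀ x, u x = 0 := by
  have cu := hu.continuous
  have cf := hf.continuous
  have cf' : Continuous (deriv f) := hf.continuous_deriv le_rfl
  have hV : Continuous fun x => deriv f (u x) := cf'.comp cu
  have hu1 := hu.of_le one_le_two
  let v : EuclideanSpace ℝ (Fin N) := EuclideanSpace.single ⟨0, hN⟩ 1
  have hv1 : ‖v‖ = 1 := by simp [v]
  have hv0 : v ≠ 0 := norm_ne_zero_iff.1 (hv1 ▸ one_ne_zero)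
  have hw : ContDiff ℝ 1 fun y => fderiv ℝ u y v := hu.fderiv_apply_const le_rfl v
  have hstab1 : ∀ φ : EuclideanSpace ℝ (Fin N) → ℝ, ContDiff ℝ 1 φ → HasCompactSupport φ →
      0 ≤ ∫ x, (‖gradient φ x‖ ^ 2 - deriv f (u x) * φ x ^ 2) := fun φ hφ hc => by
    obtain ⟨ψ, hψ, hψc, hlim⟩ := exists_smooth_tendsto_integral (μ := volume) hφ hc
    exact ge_of_tendsto' (hlim (fun x a b => ‖b‖ ^ 2 - deriv f (u x) * a ^ 2) (by fun_prop)
      (by simp)) fun n => hstab _ (hψ n) (hψc n)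
  have hweak := fun φ hφ hc => integral_linearized_eq_zero hf hu heq v (φ := φ) hφ hc
  obtain ⟨K, hK⟩ : ∃ K, ∀ x, |u x| ≤ K := by
    have := ZeroAtInftyContinuousMap.isBounded_range
      (⟨⟨u, cu⟩, hloc⟩ : ZeroAtInftyContinuousMap (EuclideanSpace ℝ (Fin N)) ℝ)
    obtain ⟨K, hK⟩ := this.exists_norm_le
    exact ⟨K, fun x => hK _ ⟨x, rfl⟩⟩
  obtain ⟨M, hM⟩ : ∃ M, ∀ x, -M ≤ deriv f (u x) := by
    obtain ⟨M, hM⟩ := (isCompact_Icc (a := -K) (b := K)).exists_bound_of_continuousOn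
      cf'.continuousOn
    exact ⟨M, fun x => (abs_le.1 (hM _ (abs_le.1 (hK x)))).1⟩
  obtain ⟨C, hC⟩ : ∃ C, ∀ R : ℝ, 1 ≤ R →
      ∫ x, paraboloidPow 1 (1 / R ^ 2) 0 (N + 2) x ^ 2 * ‖gradient u x‖ ^ 2 ≤ C := by
    have hg := hasCompactSupport_max_zero (c := -deriv f 0 / 2)
      (hf.differentiable one_ne_zero 0) hf0 (by linarith) (by ring) hloc
    refine exists_forall_integral_cutoff_le (c := -deriv f 0 / 2) (U := K ^ 2) hu (by linarith)
      (fun x => sq_le_sq' (abs_le.1 (hK x)).1 (abs_le.1 (hK x)).2)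
      (Continuous.integrable_of_hasCompactSupport (by fun_prop) hg)
      (fun x => le_max_left _ _) fun x => ?_
    rw [eq_neg_of_add_eq_zero_left (heq x)]
    linarith [le_max_right 0 (-deriv f 0 / 2 * u x ^ 2 + u x * f (u x))]
  let η : ℕ → EuclideanSpace ℝ (Fin N) → ℝ := fun n =>
    paraboloidPow 1 (1 / ((n : ℝ) + 1) ^ 2) 0 (N + 3)
  have hη : ∀ n, ContDiff ℝ 1 (η n) := fun n => contDiff_paraboloidPow (m := 1) _ _ _ (by omega)
  have hηc : ∀ n, HasCompactSupport (η n) := fun n =>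
    hasCompactSupport_paraboloidPow _ _ (by positivity) (N + 2)
  have hη1 : ∀ n x, |η n x| ≤ 1 := fun n x => by
    rw [abs_of_nonneg (paraboloidPow_nonneg _ _ _ _ _)]
    exact paraboloidPow_le_one (by positivity) _ _ _
  have h0 : Tendsto (fun n : ℕ => 1 / ((n : ℝ) + 1) ^ 2) atTop (𝓝 0) := by
    simpa using (tendsto_one_div_add_atTop_nhds_zero_nat (𝕜 := ℝ)).pow 2
  have hlim : ∀ x, Tendsto (fun n => η n x) atTop (𝓝 1) := fun x => by
    have hcont : Continuous fun b : ℝ => paraboloidPow 1 b 0 (N + 3) x := by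
      unfold paraboloidPow
      fun_prop
    have h1 : paraboloidPow 1 0 0 (N + 3) x = 1 := by simp [paraboloidPow]
    exact h1 ▸ (hcont.tendsto 0).comp h0
  have henergy : Tendsto (fun n => ∫ x, fderiv ℝ u x v ^ 2 * ‖gradient (η n) x‖ ^ 2) atTop
      (𝓝 0) := by
    have hup := h0.mul_const (4 * ((N + 1 : ℕ) + 2 : ℝ) ^ 2 * C)
    rw [zero_mul] at hup
    refine squeeze_zero (fun n => integral_nonneg fun x => by positivity) (fun n => ?_) hup
    have c1 := (hη n).continuous_gradient
    have c2 := hw.continuous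
    have c3 := hu1.continuous_gradient
    set χ := paraboloidPow 1 (1 / ((n : ℝ) + 1) ^ 2) (0 : EuclideanSpace ℝ (Fin N)) (N + 2)
    have hχc : HasCompactSupport χ := hasCompactSupport_paraboloidPow _ _ (by positivity) (N + 1)
    have c4 : Continuous χ := (contDiff_paraboloidPow (m := 0) _ _ _ (by omega)).continuous
    have key := integral_mono (f := fun x => fderiv ℝ u x v ^ 2 * ‖gradient (η n) x‖ ^ 2)
      (g := fun x => 4 * ((N + 1 : ℕ) + 2 : ℝ) ^ 2 / ((n : ℝ) + 1) ^ 2 *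
        (χ x ^ 2 * ‖gradient u x‖ ^ 2)) (μ := volume)
      ((hηc n).integrable_of_eq_zero (by fun_prop) fun x hx => by
        simp [gradient_eq_zero_of_notMem_tsupport hx])
      (hχc.integrable_of_eq_zero (by fun_prop) fun x hx => by
        simp [image_eq_zero_of_notMem_tsupport hx]) fun x => ?_
    · rw [integral_const_mul] at key
      refine key.trans ?_
      calc _ ≤ 4 * ((N + 1 : ℕ) + 2 : ℝ) ^ 2 / ((n : ℝ) + 1) ^ 2 * C := by
            gcongr
            exact hC _ (by simp)
        _ = _ := by ring
    · have h1 : fderiv ℝ u x v ^ 2 ≤ ‖gradient u x‖ ^ 2 := by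
        rw [← inner_gradient, ← sq_abs]
        gcongr
        simpa [hv1] using abs_real_inner_le_norm (gradient u x) v
      have h2 := norm_gradient_paraboloidPow_sq_le (by positivity : 0 < (n : ℝ) + 1) (N + 1) x
      calc fderiv ℝ u x v ^ 2 * ‖gradient (η n) x‖ ^ 2
          ≤ ‖gradient u x‖ ^ 2 *
            (4 * ((N + 1 : ℕ) + 2 : ℝ) ^ 2 / ((n : ℝ) + 1) ^ 2 * χ x ^ 2) := by
            gcongr
        _ = _ := by ring
  have hsign := nonneg_or_nonpos_of_integral_abs hV hM hw.continuous (fun φ hφ hc => by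
      rw [← neg_eq_zero, ← integral_bilinearForm hV hw hφ hc]
      exact hweak φ (hφ.of_le one_le_two) hc)
    fun φ hφ hc => integral_abs_mul_eq_zero hV hw hstab1 hweak hη hηc hη1 hlim henergy hφ hc
  have hud := hu.differentiable two_ne_zero
  rcases hsign with h | h
  · exact eq_zero_of_forall_fderiv_nonneg hud hloc hv0 h
  · exact eq_zero_of_forall_fderiv_nonneg hud hloc (neg_ne_zero.2 hv0) fun x => by
      rw [map_neg]
      exact neg_nonneg.2 (h x)
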